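/- Any data structure solving the Rank with Additive Approximation problem with additive error ε on quad vectors of length n requires Ω(n/ε) bits of space: concretely, a family of data structures using fewer than (2n/(3ε)) − ω(1) bits each cannot answer all approximate rank queries correctly for all quad vectors of length n, since combined with the reconstruction procedure on expanded vectors this would contradict the 2m-bit information-theoretic lower bound for quad vectors of length m. -/

import Mathlib

/-- `qrank n Q α i` counts occurrences of `α` among the first `i` positions
of the quad vector `Q`. -/
def qrank (n : ℕ) (Q : Fin n → Fin 4) (α : Fin 4) (i : ℕ) : ℕ :=
  (Finset.univ.filter (fun p : Fin n => (p : ℕ) < i ∧ Q p = α)).card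

/-- There are fewer than `2 ^ N` bit strings of length less than `N`. -/
theorem card_lt_two_pow_of_injective {X : Type*} [Fintype X] {N : ℕ}
    {f : X → {l : List Bool // l.length < N}} (hf : Function.Injective f) :
    Fintype.card X < 2 ^ N := by
  let g : {l : List Bool // l.length < N} → (k : Fin N) × List.Vector Bool k :=
    fun l => ⟨⟨l.1.length, l.2⟩, ⟨l.1, rfl⟩⟩
  have hg : Function.LeftInverse
      (fun s : (k : Fin N) × List.Vector Bool k =>
        (⟨s.2.1, s.2.2.symm ▸ s.1.2⟩ : {l : List Bool // l.length < N})) g := fun _ => rfl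
  calc Fintype.card X ≤ Fintype.card ((k : Fin N) × List.Vector Bool k) :=
        Fintype.card_le_of_injective _ (hg.injective.comp hf)
    _ = ∑ k ∈ Finset.range N, 2 ^ k := by
        simp [Fintype.card_sigma, card_vector, Finset.sum_range]
    _ < 2 ^ N := Nat.geomSum_lt le_rfl (by simp)

/-- The vector in which every entry of `v` is repeated `L` times. -/
def expand (L m : ℕ) (v : Fin m → Fin 4) (p : Fin (L * m)) : Fin 4 :=
  v ⟨p / L, Nat.div_lt_of_lt_mul p.2⟩

/-- If `v` and `w` agree before position `k` but differ there, then the rank of `v k` at the end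
of the `k`-th run is larger by at least `L` in the expansion of `v` than in that of `w`. -/
theorem qrank_expand_add_le {L m : ℕ} (v w : Fin m → Fin 4) (k : Fin m)
    (h : ∀ j < k, v j = w j) (hk : v k ≠ w k) :
    qrank (L * m) (expand L m w) (v k) (L * (k + 1)) + L ≤
      qrank (L * m) (expand L m v) (v k) (L * (k + 1)) := by
  have hkm : L * (k + 1) ≤ L * m := Nat.mul_le_mul_left L k.2
  let B : Finset (Fin (L * m)) := (Finset.Ico (L * k) (L * (k + 1))).attachFin
    fun p hp => (Finset.mem_Ico.1 hp).2.trans_le hkm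
  have hB : B.card = L := by
    simp [B, Finset.card_attachFin, Nat.mul_add]
  have run {p : Fin (L * m)} (h₁ : L * k ≤ p) (h₂ : (p : ℕ) < L * (k + 1)) (u : Fin m → Fin 4) :
      expand L m u p = u k :=
    congrArg u (Fin.ext (Nat.div_eq_of_lt_le (mul_comm L k ▸ h₁) (mul_comm L (k + 1) ▸ h₂)))
  unfold qrank
  refine (congrArg (_ + ·) hB.symm).trans_le ?_
  rw [← Finset.card_union_of_disjoint]
  · refine Finset.card_le_card fun p hp => ?_
    simp only [B, Finset.mem_union, Finset.mem_filter, Finset.mem_univ, true_and,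
      Finset.mem_attachFin, Finset.mem_Ico] at hp ⊢
    rcases hp with ⟨hlt, hw⟩ | ⟨hle, hlt⟩
    · refine ⟨hlt, ?_⟩
      rcases lt_or_ge (p : ℕ) (L * k) with hp | hp
      · exact (h _ (Nat.div_lt_of_lt_mul hp)).trans hw
      · exact run hp hlt v
    · exact ⟨hlt, run hle hlt v⟩
  · refine Finset.disjoint_left.2 fun p hp hpB => ?_
    simp only [B, Finset.mem_filter, Finset.mem_univ, true_and,
      Finset.mem_attachFin, Finset.mem_Ico] at hp hpB
    exact hk (hp.2.symm.trans (run hpB.1 hpB.2 w))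

/-- Space lower bound for Rank with Additive Approximation: no data
structure that encodes every quad vector of length `n = 3εm` into fewer
than `2n/(3ε) = 2m` bits can answer all rank queries with additive error
`ε` — otherwise, via the reconstruction on expanded vectors, one would
obtain an injective encoding of length-`m` quad vectors into fewer than
`2m` bits, contradicting the information-theoretic lower bound. -/
theorem approx_rank_space_lower_bound (m ε : ℕ) (hε : 1 ≤ ε) :
    ¬ ∃ (enc : (Fin (3 * ε * m) → Fin 4) → {l : List Bool // l.length < 2 * m})
        (ans : {l : List Bool // l.length < 2 * m} → Fin 4 → ℕ → ℕ),
        ∀ (Q : Fin (3 * ε * m) → Fin 4) (α : Fin 4) (j : ℕ),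
          qrank (3 * ε * m) Q α j ≤ ans (enc Q) α j ∧
            ans (enc Q) α j ≤ qrank (3 * ε * m) Q α j + ε := by
  rintro ⟨enc, ans, hans⟩
  have hinj : Function.Injective fun v => enc (expand (3 * ε) m v) := by
    intro v w hvw
    funext k
    induction k using WellFoundedLT.induction with
    | ind k ih =>
      by_contra hk
      have hgap := qrank_expand_add_le (L := 3 * ε) v w k ih hk
      have hv := (hans (expand (3 * ε) m v) (v k) (3 * ε * (k + 1))).1
      have hw := (hans (expand (3 * ε) m w) (v k) (3 * ε * (k + 1))).2
      rw [show enc (expand (3 * ε) m v) = enc (expand (3 * ε) m w) from hvw] at hv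
      omega
  have hcard := card_lt_two_pow_of_injective hinj
  simp [pow_mul] at hcard
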